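/- (Proposition 3.3, LRD of the inverse mixed stable subordinator) Fix s > 0 and assume Var_Y(s) > 0. Let Corr_Y(s,t) = Cov_Y(s,t)/(√Var_Y(s) √Var_Y(t)). Then lim_{t→∞} t^{α₂} Corr_Y(s,t) = (s^{2α₁}/C₁²) E²_{α₁−α₂, 2α₁+1}(−C₂ s^{α₁−α₂}/C₁) / (√Var_Y(s) · √((1/C₂²)(2/Γ(2α₂+1) − 1/Γ(α₂+1)²))). In particular, since 0 < α₂ < 1, the inverse mixed stable subordinator has the long-range dependence property. -/

import Mathlib

open Real MeasureTheory Filter Topology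

/-- Two-parameter Mittag-Leffler function `E_{a,b}(x)`. -/
noncomputable def ML (a b x : ℝ) : ℝ :=
  ∑' k : ℕ, x ^ k / Real.Gamma ((k : ℝ) * a + b)

/-- Second-order (three-parameter, `γ = 2`) Mittag-Leffler function `E²_{a,b}(x)`. -/
noncomputable def ML2 (a b x : ℝ) : ℝ :=
  ∑' k : ℕ, ((k : ℝ) + 1) * x ^ k / Real.Gamma ((k : ℝ) * a + b)

/-- Renewal function `U(t)` of the inverse mixed stable subordinator. -/
noncomputable def Ufun (a1 a2 C1 C2 t : ℝ) : ℝ :=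
  t ^ a1 / C1 * ML (a1 - a2) (a1 + 1) (-C2 * t ^ (a1 - a2) / C1)

/-- Renewal density `u(t)` of the inverse mixed stable subordinator. -/
noncomputable def ufun (a1 a2 C1 C2 t : ℝ) : ℝ :=
  t ^ (a1 - 1) / C1 * ML (a1 - a2) a1 (-C2 * t ^ (a1 - a2) / C1)

/-- Covariance function of the inverse mixed stable subordinator. -/
noncomputable def CovY (a1 a2 C1 C2 s t : ℝ) : ℝ :=
  (∫ τ in (0:ℝ)..(min s t),
      (Ufun a1 a2 C1 C2 (s - τ) + Ufun a1 a2 C1 C2 (t - τ)) * ufun a1 a2 C1 C2 τ)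
    - Ufun a1 a2 C1 C2 s * Ufun a1 a2 C1 C2 t

/-- Variance function of the inverse mixed stable subordinator. -/
noncomputable def VarY (a1 a2 C1 C2 t : ℝ) : ℝ := CovY a1 a2 C1 C2 t t

/-- The integral `I(s,t) = ∫₀^s U(t-τ) u(τ) dτ`. -/
noncomputable def Ifun (a1 a2 C1 C2 s t : ℝ) : ℝ :=
  ∫ τ in (0:ℝ)..s, Ufun a1 a2 C1 C2 (t - τ) * ufun a1 a2 C1 C2 τ

/-- The constant `K(s)`. -/
noncomputable def Kfun (a1 a2 C1 C2 s : ℝ) : ℝ :=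
  s ^ (a1 + 1) / (C1 * C2 * Real.Gamma a2) *
    ∑' k : ℕ, ((k : ℝ) * (a1 - a2) + a1) * (-C2 * s ^ (a1 - a2) / C1) ^ k /
      Real.Gamma ((k : ℝ) * (a1 - a2) + a1 + 2)

/-- Covariance function of the mixed fractional Poisson process. -/
noncomputable def CovN (a1 a2 C1 C2 lam s t : ℝ) : ℝ :=
  lam * Ufun a1 a2 C1 C2 (min s t) + lam ^ 2 * CovY a1 a2 C1 C2 s t

/-- Variance function of the mixed fractional Poisson process. -/
noncomputable def VarN (a1 a2 C1 C2 lam t : ℝ) : ℝ :=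
  lam * Ufun a1 a2 C1 C2 t + lam ^ 2 * VarY a1 a2 C1 C2 t

/-- Correlation function of the inverse mixed stable subordinator. -/
noncomputable def CorrY (a1 a2 C1 C2 s t : ℝ) : ℝ :=
  CovY a1 a2 C1 C2 s t /
    (Real.sqrt (VarY a1 a2 C1 C2 s) * Real.sqrt (VarY a1 a2 C1 C2 t))

/-- Correlation function of the mixed fractional Poisson process. -/
noncomputable def CorrN (a1 a2 C1 C2 lam s t : ℝ) : ℝ :=
  CovN a1 a2 C1 C2 lam s t /
    (Real.sqrt (VarN a1 a2 C1 C2 lam s) * Real.sqrt (VarN a1 a2 C1 C2 lam t))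

/-- Covariance function of the mixed fractional Poissonian noise. -/
noncomputable def CovZ (a1 a2 C1 C2 lam δ s t : ℝ) : ℝ :=
  CovN a1 a2 C1 C2 lam (s + δ) (t + δ) + CovN a1 a2 C1 C2 lam s t
    - CovN a1 a2 C1 C2 lam (s + δ) t - CovN a1 a2 C1 C2 lam s (t + δ)

/-- Variance function of the mixed fractional Poissonian noise. -/
noncomputable def VarZ (a1 a2 C1 C2 lam δ t : ℝ) : ℝ := CovZ a1 a2 C1 C2 lam δ t t

/-- Correlation function of the mixed fractional Poissonian noise. -/
noncomputable def CorrZ (a1 a2 C1 C2 lam δ s t : ℝ) : ℝ :=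
  CovZ a1 a2 C1 C2 lam δ s t /
    (Real.sqrt (VarZ a1 a2 C1 C2 lam δ s) * Real.sqrt (VarZ a1 a2 C1 C2 lam δ t))

/-- Incomplete Beta function `B(a, b; x)`. -/
noncomputable def Binc (a b x : ℝ) : ℝ :=
  ∫ y in (0:ℝ)..x, y ^ (a - 1) * (1 - y) ^ (b - 1)

theorem rpow_mul_exp_neg_le_Gamma {y N : ℝ} (hy : 1 ≤ y) (hN : 0 < N) :
    N ^ (y - 1) * Real.exp (-N) ≤ Real.Gamma y := by
  have hy0 : 0 < y := by linarith
  have hi := Real.GammaIntegral_convergent hy0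
  have hsub : Set.Ioi N ⊆ Set.Ioi (0 : ℝ) := Set.Ioi_subset_Ioi hN.le
  rw [Real.Gamma_eq_integral hy0]
  calc N ^ (y - 1) * Real.exp (-N) = ∫ x in Set.Ioi N, N ^ (y - 1) * Real.exp (-x) := by
        rw [integral_const_mul, integral_exp_neg_Ioi]
    _ ≤ ∫ x in Set.Ioi N, Real.exp (-x) * x ^ (y - 1) := by
        refine setIntegral_mono_on ?_ (hi.mono_set hsub) measurableSet_Ioi fun x hx => ?_
        · exact (integrableOn_exp_neg_Ioi N).const_mul _
        · rw [mul_comm]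
          have hx' : N ≤ x := le_of_lt hx
          gcongr
    _ ≤ ∫ x in Set.Ioi 0, Real.exp (-x) * x ^ (y - 1) := by
        refine setIntegral_mono_set hi ?_ hsub.eventuallyLE
        filter_upwards [ae_restrict_mem measurableSet_Ioi] with x hx
        have : (0 : ℝ) < x := hx
        positivity

theorem summable_pow_div_Gamma {a b : ℝ} (ha : 0 < a) (x : ℝ) :
    Summable fun k : ℕ => x ^ k / Real.Gamma ((k : ℝ) * a + b) := by
  obtain ⟨N, hN, hNx⟩ : ∃ N : ℝ, 0 < N ∧ 2 * |x| ≤ N ^ a := by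
    refine ⟨(2 * |x| + 1) ^ (1 / a), by positivity, ?_⟩
    rw [← Real.rpow_mul (by positivity), one_div_mul_cancel ha.ne', Real.rpow_one]
    linarith
  have hNa : 0 < N ^ a := by positivity
  have hgeo : Summable fun k : ℕ => (Real.exp N * N ^ (1 - b)) * (1 / 2 : ℝ) ^ k :=
    (summable_geometric_of_lt_one (by norm_num) (by norm_num)).mul_left _
  refine hgeo.of_norm_bounded_eventually_nat ?_
  have hev : ∀ᶠ k : ℕ in atTop, 1 ≤ (k : ℝ) * a + b :=
    (tendsto_atTop_add_const_right _ b
      (tendsto_natCast_atTop_atTop.atTop_mul_const ha)).eventually_ge_atTop 1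
  filter_upwards [hev] with k hk
  have hΓ := rpow_mul_exp_neg_le_Gamma hk hN
  have hΓ0 : 0 < Real.Gamma ((k : ℝ) * a + b) := Real.Gamma_pos_of_pos (by linarith)
  rw [norm_div, Real.norm_of_nonneg hΓ0.le, norm_pow, Real.norm_eq_abs, div_le_iff₀ hΓ0]
  have hN1 : N ^ ((k : ℝ) * a + b - 1) = (N ^ a) ^ k * N ^ (b - 1) := by
    rw [add_sub_assoc, Real.rpow_add hN, mul_comm (k : ℝ) a, Real.rpow_mul_natCast hN.le]
  have hN2 : N ^ (1 - b) * N ^ (b - 1) = 1 := by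
    rw [← Real.rpow_add hN]; simp
  have hE : Real.exp N * Real.exp (-N) = 1 := by rw [← Real.exp_add]; simp
  calc |x| ^ k ≤ (1 / 2 * N ^ a) ^ k := by gcongr; linarith
    _ = (Real.exp N * Real.exp (-N)) * (N ^ (1 - b) * N ^ (b - 1)) * ((1 / 2) ^ k * (N ^ a) ^ k) := by
        rw [hE, hN2, mul_pow]; ring
    _ = Real.exp N * N ^ (1 - b) * (1 / 2) ^ k * (N ^ ((k : ℝ) * a + b - 1) * Real.exp (-N)) := by
        rw [hN1]; ring
    _ ≤ _ := by gcongr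

/-- A real sequence dominated by a geometric sequence. -/
def GeomBounded (c : ℕ → ℝ) : Prop := ∃ M L : ℝ, 0 ≤ M ∧ 0 ≤ L ∧ ∀ k, |c k| ≤ M * L ^ k

theorem GeomBounded.summable {c : ℕ → ℝ} (hc : GeomBounded c) {a b : ℝ} (ha : 0 < a) (hb : 0 < b)
    (x : ℝ) : Summable fun k : ℕ => ‖c k * x ^ k / Real.Gamma ((k : ℝ) * a + b)‖ := by
  obtain ⟨M, L, hM, hL, h⟩ := hc
  refine Summable.of_nonneg_of_le (fun _ => norm_nonneg _) (fun k => ?_)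
    ((summable_pow_div_Gamma (b := b) ha (L * |x|)).mul_left M)
  have hΓ0 : 0 < Real.Gamma ((k : ℝ) * a + b) := Real.Gamma_pos_of_pos (by positivity)
  rw [norm_div, Real.norm_of_nonneg hΓ0.le, norm_mul, norm_pow, Real.norm_eq_abs, Real.norm_eq_abs,
    ← mul_div_assoc, mul_pow, ← mul_assoc]
  gcongr
  exact h k

/-- The entire series `∑ cₖ xᵏ / Γ(k a + b)`. -/
noncomputable def gammaSeries (c : ℕ → ℝ) (a b x : ℝ) : ℝ :=
  ∑' k : ℕ, c k * x ^ k / Real.Gamma ((k : ℝ) * a + b)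

/-- The function `t ↦ ∑ cₖ t^(k a + b - 1) / Γ(k a + b)`. -/
noncomputable def fracSeries (c : ℕ → ℝ) (a b t : ℝ) : ℝ :=
  t ^ (b - 1) * gammaSeries c a b (t ^ a)

theorem differentiable_gammaSeries {c : ℕ → ℝ} (hc : GeomBounded c) {a b : ℝ} (ha : 0 < a)
    (hb : 0 < b) : Differentiable ℝ (gammaSeries c a b) := by
  intro x
  have hc' : GeomBounded fun k => c k * 2 ^ k := by
    obtain ⟨M, L, hM, hL, h⟩ := hc
    refine ⟨M, 2 * L, hM, by positivity, fun k => ?_⟩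
    rw [abs_mul, mul_pow, abs_of_pos (show (0:ℝ) < 2 ^ k by positivity)]
    nlinarith [mul_le_mul_of_nonneg_right (h k) (show (0:ℝ) ≤ 2 ^ k by positivity)]
  set R : ℝ := |x| + 1 with hR
  have hR1 : 1 ≤ R := by linarith [abs_nonneg x]
  have hu := hc'.summable ha hb R
  refine (hasDerivAt_tsum_of_isPreconnected
    (g := fun k y => c k * y ^ k / Real.Gamma ((k : ℝ) * a + b))
    (g' := fun k y => c k * (k * y ^ (k - 1)) / Real.Gamma ((k : ℝ) * a + b))
    hu (t := Metric.ball 0 R) Metric.isOpen_ball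
    (convex_ball 0 R).isPreconnected ?_ ?_ (y₀ := x) ?_ ?_ ?_).differentiableAt
  · intro k y _
    exact ((hasDerivAt_pow k y).const_mul (c k)).div_const _
  · intro k y hy
    have hy' : |y| ≤ R := by simpa using (mem_ball_zero_iff.1 hy).le
    have hΓ0 : 0 < Real.Gamma ((k : ℝ) * a + b) := Real.Gamma_pos_of_pos (by positivity)
    rw [norm_div, norm_div]
    gcongr
    rw [mul_assoc, norm_mul (c k), norm_mul (c k)]
    gcongr
    rw [norm_mul, norm_mul, norm_pow, norm_pow, norm_pow, Real.norm_natCast, Real.norm_eq_abs,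
      Real.norm_eq_abs, Real.norm_eq_abs, abs_of_pos (show (0:ℝ) < 2 by norm_num),
      abs_of_pos (show (0:ℝ) < R by linarith)]
    have h1 : (k : ℝ) ≤ 2 ^ k := by exact_mod_cast (Nat.lt_two_pow_self).le
    have h2 : |y| ^ (k - 1) ≤ R ^ k :=
      (pow_le_pow_left₀ (abs_nonneg y) hy' _).trans (pow_le_pow_right₀ hR1 (Nat.sub_le _ _))
    gcongr
  · rw [mem_ball_zero_iff, Real.norm_eq_abs]; linarith
  · exact (hc.summable ha hb x).of_norm
  · rw [mem_ball_zero_iff, Real.norm_eq_abs]; linarith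

theorem differentiableAt_fracSeries {c : ℕ → ℝ} (hc : GeomBounded c) {a b t : ℝ} (ha : 0 < a)
    (hb : 0 < b) (ht : 0 < t) : DifferentiableAt ℝ (fracSeries c a b) t :=
  (Real.differentiableAt_rpow_const_of_ne _ ht.ne').mul
    ((differentiable_gammaSeries hc ha hb _).comp t (Real.differentiableAt_rpow_const_of_ne _ ht.ne'))

theorem intervalIntegrable_fracSeries {c : ℕ → ℝ} (hc : GeomBounded c) {a b : ℝ} (ha : 0 < a)
    (hb : 0 < b) (t : ℝ) : IntervalIntegrable (fracSeries c a b) volume 0 t := by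
  refine (intervalIntegral.intervalIntegrable_rpow' (by linarith)).mul_continuousOn ?_
  exact ((differentiable_gammaSeries hc ha hb).continuous.comp
    (Real.continuous_rpow_const ha.le)).continuousOn

theorem continuous_fracSeries {c : ℕ → ℝ} (hc : GeomBounded c) {a b : ℝ} (ha : 0 < a)
    (hb : 1 ≤ b) : Continuous (fracSeries c a b) :=
  (Real.continuous_rpow_const (by linarith)).mul
    ((differentiable_gammaSeries hc ha (by linarith)).continuous.comp
      (Real.continuous_rpow_const ha.le))

theorem integral_rpow_mul_sub_rpow {x y t : ℝ} (hx : 0 < x) (hy : 0 < y) (ht : 0 < t) :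
    ∫ τ in (0:ℝ)..t, τ ^ (x - 1) * (t - τ) ^ (y - 1) =
      t ^ (x + y - 1) * (Real.Gamma x * Real.Gamma y / Real.Gamma (x + y)) := by
  have h := Complex.betaIntegral_scaled (x : ℂ) (y : ℂ) ht
  rw [Complex.betaIntegral_eq_Gamma_mul_div _ _ (by simpa) (by simpa)] at h
  have h2 : ∫ τ in (0:ℝ)..t, (τ : ℂ) ^ ((x : ℂ) - 1) * ((t : ℂ) - τ) ^ ((y : ℂ) - 1) =
      ((∫ τ in (0:ℝ)..t, τ ^ (x - 1) * (t - τ) ^ (y - 1) : ℝ) : ℂ) := by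
    rw [← intervalIntegral.integral_ofReal]
    refine intervalIntegral.integral_congr fun τ hτ => ?_
    rw [Set.uIcc_of_le ht.le] at hτ
    simp only [Complex.ofReal_mul]
    rw [Complex.ofReal_cpow hτ.1, Complex.ofReal_cpow (by linarith [hτ.2])]
    push_cast
    rfl
  rw [h2] at h
  apply Complex.ofReal_injective
  rw [h]
  push_cast
  rw [Complex.ofReal_cpow ht.le, ← Complex.Gamma_ofReal, ← Complex.Gamma_ofReal,
    ← Complex.Gamma_ofReal]
  push_cast
  rfl

theorem intervalIntegrable_rpow_mul_sub_rpow {x y t : ℝ} (hx : 0 < x) (hy : 0 < y) (ht : 0 < t) :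
    IntervalIntegrable (fun τ : ℝ => τ ^ (x - 1) * (t - τ) ^ (y - 1)) volume 0 t := by
  refine intervalIntegral.intervalIntegrable_of_integral_ne_zero ?_
  rw [integral_rpow_mul_sub_rpow hx hy ht]
  have := Real.Gamma_pos_of_pos hx
  have := Real.Gamma_pos_of_pos hy
  have := Real.Gamma_pos_of_pos (add_pos hx hy)
  positivity

/-- The Cauchy product of two sequences. -/
def cauchyProd (c d : ℕ → ℝ) (n : ℕ) : ℝ := ∑ p ∈ Finset.HasAntidiagonal.antidiagonal n, c p.1 * d p.2

theorem fracSeries_eq_tsum {c : ℕ → ℝ} {a b t : ℝ} (ht : 0 < t) :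
    fracSeries c a b t = ∑' k : ℕ, c k * t ^ ((k : ℝ) * a + b - 1) / Real.Gamma ((k : ℝ) * a + b) := by
  rw [fracSeries, gammaSeries, ← tsum_mul_left]
  congr 1 with k
  rw [add_sub_assoc, Real.rpow_add ht, mul_comm (k : ℝ) a, Real.rpow_mul_natCast ht.le]
  ring

theorem summable_fracSeries {c : ℕ → ℝ} (hc : GeomBounded c) {a b t : ℝ} (ha : 0 < a) (hb : 0 < b)
    (ht : 0 < t) :
    Summable fun k : ℕ => ‖c k * t ^ ((k : ℝ) * a + b - 1) / Real.Gamma ((k : ℝ) * a + b)‖ := by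
  refine ((hc.summable ha hb (t ^ a)).mul_left (t ^ (b - 1))).congr fun k => ?_
  rw [add_sub_assoc, Real.rpow_add ht, mul_comm (k : ℝ) a, Real.rpow_mul_natCast ht.le,
    ← Real.norm_of_nonneg (show 0 ≤ t ^ (b - 1) by positivity), ← norm_mul,
    Real.norm_of_nonneg (show 0 ≤ t ^ (b - 1) by positivity)]
  congr 1
  ring

theorem summable_prod_mul_rpow_div_Gamma {c d : ℕ → ℝ} (hc : GeomBounded c) (hd : GeomBounded d)
    {a B t : ℝ} (ha : 0 < a) (hB : 0 < B) (ht : 0 < t) :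
    Summable fun p : ℕ × ℕ => ‖c p.1 * d p.2 * (t ^ (((p.1 + p.2 : ℕ) : ℝ) * a + B - 1) /
      Real.Gamma (((p.1 + p.2 : ℕ) : ℝ) * a + B))‖ := by
  obtain ⟨M, L, hM, hL, h⟩ := hc
  obtain ⟨M', L', hM', hL', h'⟩ := hd
  set Λ := L + L' with hΛ
  have hΛ0 : 0 ≤ Λ := by positivity
  obtain ⟨K, hK⟩ : ∃ K, ∀ n : ℕ,
      ((2 * Λ) * t ^ a) ^ n / Real.Gamma ((n : ℝ) * a + B) ≤ K := by
    obtain ⟨K, hK⟩ := (summable_pow_div_Gamma (b := B) ha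
      ((2 * Λ) * t ^ a)).tendsto_atTop_zero.bddAbove_range
    exact ⟨K, fun n => hK ⟨n, rfl⟩⟩
  have hgeo : Summable fun k : ℕ => (1 / 2 : ℝ) ^ k :=
    summable_geometric_of_lt_one (by norm_num) (by norm_num)
  have hprod : Summable fun p : ℕ × ℕ => (1 / 2 : ℝ) ^ p.1 * (1 / 2 : ℝ) ^ p.2 :=
    hgeo.mul_of_nonneg hgeo (fun _ => by positivity) (fun _ => by positivity)
  refine Summable.of_nonneg_of_le (fun _ => norm_nonneg _) (fun p => ?_)
    (hprod.mul_left (M * M' * t ^ (B - 1) * K))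
  obtain ⟨j, k⟩ := p
  have hΓ0 : 0 < Real.Gamma (((j + k : ℕ) : ℝ) * a + B) := Real.Gamma_pos_of_pos (by positivity)
  have hcj : |c j| ≤ M * Λ ^ j := (h j).trans (by gcongr; linarith)
  have hdk : |d k| ≤ M' * Λ ^ k := (h' k).trans (by gcongr; linarith)
  have hpow : t ^ (((j + k : ℕ) : ℝ) * a + B - 1) = (t ^ a) ^ (j + k) * t ^ (B - 1) := by
    rw [add_sub_assoc, Real.rpow_add ht, mul_comm _ a, Real.rpow_mul_natCast ht.le]
  rw [norm_mul, norm_mul, Real.norm_eq_abs, Real.norm_eq_abs, Real.norm_of_nonneg (by positivity)]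
  calc |c j| * |d k| * (t ^ (((j + k : ℕ) : ℝ) * a + B - 1) / Real.Gamma (((j + k : ℕ) : ℝ) * a + B))
      ≤ (M * Λ ^ j) * (M' * Λ ^ k) *
        (t ^ (((j + k : ℕ) : ℝ) * a + B - 1) / Real.Gamma (((j + k : ℕ) : ℝ) * a + B)) := by
        gcongr
    _ = M * M' * t ^ (B - 1) * ((1 / 2) ^ j * (1 / 2) ^ k) *
        (((2 * Λ) * t ^ a) ^ (j + k) / Real.Gamma (((j + k : ℕ) : ℝ) * a + B)) := by
        rw [hpow, mul_pow, mul_pow, ← pow_add (1 / 2 : ℝ), one_div, inv_pow, pow_add Λ]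
        field_simp
    _ ≤ M * M' * t ^ (B - 1) * ((1 / 2) ^ j * (1 / 2) ^ k) * K := by
        gcongr
        exact hK _
    _ = _ := by ring

theorem integral_fracSeries_mul_fracSeries {c d : ℕ → ℝ} (hc : GeomBounded c) (hd : GeomBounded d)
    {a b b' t : ℝ} (ha : 0 < a) (hb : 0 < b) (hb' : 0 < b') (ht : 0 < t) :
    ∫ τ in (0:ℝ)..t, fracSeries c a b τ * fracSeries d a b' (t - τ) =
      fracSeries (cauchyProd c d) a (b + b') t := by
  set f : ℕ × ℕ → ℝ → ℝ := fun p τ =>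
    (c p.1 * τ ^ ((p.1 : ℝ) * a + b - 1) / Real.Gamma ((p.1 : ℝ) * a + b)) *
    (d p.2 * (t - τ) ^ ((p.2 : ℝ) * a + b' - 1) / Real.Gamma ((p.2 : ℝ) * a + b')) with hf
  have hf' : ∀ p τ, f p τ = (c p.1 / Real.Gamma ((p.1 : ℝ) * a + b) *
      (d p.2 / Real.Gamma ((p.2 : ℝ) * a + b'))) *
      (τ ^ ((p.1 : ℝ) * a + b - 1) * (t - τ) ^ ((p.2 : ℝ) * a + b' - 1)) := by
    intro p τ; simp only [hf]; ring
  have hval : ∀ p : ℕ × ℕ, ∀ x y : ℝ, (x / Real.Gamma ((p.1 : ℝ) * a + b) *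
      (y / Real.Gamma ((p.2 : ℝ) * a + b'))) *
      (∫ τ in (0:ℝ)..t, τ ^ ((p.1 : ℝ) * a + b - 1) * (t - τ) ^ ((p.2 : ℝ) * a + b' - 1)) =
      x * y * (t ^ (((p.1 + p.2 : ℕ) : ℝ) * a + (b + b') - 1) /
      Real.Gamma (((p.1 + p.2 : ℕ) : ℝ) * a + (b + b'))) := by
    intro p x y
    have h1 := Real.Gamma_pos_of_pos (show 0 < (p.1 : ℝ) * a + b by positivity)
    have h2 := Real.Gamma_pos_of_pos (show 0 < (p.2 : ℝ) * a + b' by positivity)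
    rw [integral_rpow_mul_sub_rpow (by positivity) (by positivity) ht,
      show (p.1 : ℝ) * a + b + ((p.2 : ℝ) * a + b') =
        ((p.1 + p.2 : ℕ) : ℝ) * a + (b + b') by push_cast; ring]
    field_simp
  have hint : ∀ p, Integrable (f p) (volume.restrict (Set.Ioc 0 t)) := by
    intro p
    have := (intervalIntegrable_rpow_mul_sub_rpow (x := (p.1 : ℝ) * a + b)
      (y := (p.2 : ℝ) * a + b') (by positivity) (by positivity) ht).const_mul
      (c p.1 / Real.Gamma ((p.1 : ℝ) * a + b) * (d p.2 / Real.Gamma ((p.2 : ℝ) * a + b')))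
    rw [intervalIntegrable_iff_integrableOn_Ioc_of_le ht.le] at this
    exact this.congr (ae_of_all _ fun τ => (hf' p τ).symm)
  have hfint : ∀ p : ℕ × ℕ, ∫ τ in Set.Ioc 0 t, f p τ =
      c p.1 * d p.2 * (t ^ (((p.1 + p.2 : ℕ) : ℝ) * a + (b + b') - 1) /
      Real.Gamma (((p.1 + p.2 : ℕ) : ℝ) * a + (b + b'))) := by
    intro p
    rw [← hval, ← intervalIntegral.integral_const_mul, intervalIntegral.integral_of_le ht.le]
    exact integral_congr_ae (ae_of_all _ fun τ => hf' p τ)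
  have hfnorm : ∀ p : ℕ × ℕ, ∫ τ in Set.Ioc 0 t, ‖f p τ‖ =
      ‖c p.1 * d p.2 * (t ^ (((p.1 + p.2 : ℕ) : ℝ) * a + (b + b') - 1) /
      Real.Gamma (((p.1 + p.2 : ℕ) : ℝ) * a + (b + b')))‖ := by
    intro p
    have h1 := Real.Gamma_pos_of_pos (show 0 < (p.1 : ℝ) * a + b by positivity)
    have h2 := Real.Gamma_pos_of_pos (show 0 < (p.2 : ℝ) * a + b' by positivity)
    have h3 := Real.Gamma_pos_of_pos
      (show 0 < ((p.1 + p.2 : ℕ) : ℝ) * a + (b + b') by positivity)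
    rw [norm_mul, Real.norm_of_nonneg (show 0 ≤ t ^ (((p.1 + p.2 : ℕ) : ℝ) * a + (b + b') - 1) /
      Real.Gamma (((p.1 + p.2 : ℕ) : ℝ) * a + (b + b')) by positivity), norm_mul,
      ← hval, ← intervalIntegral.integral_const_mul, intervalIntegral.integral_of_le ht.le]
    refine setIntegral_congr_fun measurableSet_Ioc fun τ hτ => ?_
    have h4 : 0 < τ := hτ.1
    have h5 : 0 ≤ t - τ := by linarith [hτ.2]
    simp only [hf']
    rw [norm_mul, norm_mul, norm_div, norm_div, Real.norm_of_nonneg h1.le, Real.norm_of_nonneg h2.le,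
      Real.norm_of_nonneg (show 0 ≤ τ ^ ((p.1 : ℝ) * a + b - 1) *
        (t - τ) ^ ((p.2 : ℝ) * a + b' - 1) by positivity)]
  have hsum := summable_prod_mul_rpow_div_Gamma hc hd ha (add_pos hb hb') ht
  have key := hasSum_integral_of_summable_integral_norm hint (by simpa only [hfnorm] using hsum)
  simp only [hfint] at key
  have hlhs : ∫ τ in (0:ℝ)..t, fracSeries c a b τ * fracSeries d a b' (t - τ) =
      ∫ τ in Set.Ioc 0 t, ∑' p, f p τ := by
    rw [intervalIntegral.integral_of_le ht.le, integral_Ioc_eq_integral_Ioo,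
      integral_Ioc_eq_integral_Ioo]
    refine setIntegral_congr_fun measurableSet_Ioo fun τ hτ => ?_
    have h5 : 0 < t - τ := by linarith [hτ.2]
    rw [fracSeries_eq_tsum hτ.1, fracSeries_eq_tsum h5,
      tsum_mul_tsum_of_summable_norm (summable_fracSeries hc ha hb hτ.1)
        (summable_fracSeries hd ha hb' h5)]
  rw [hlhs, ← key.tsum_eq, fracSeries_eq_tsum ht,
    ← Finset.HasAntidiagonal.sigmaAntidiagonalEquivProd.tsum_eq]
  refine (Summable.tsum_sigma' (fun n => (hasSum_fintype _).summable)
    (Finset.HasAntidiagonal.sigmaAntidiagonalEquivProd.summable_iff.2 hsum.of_norm)).trans ?_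
  refine tsum_congr fun n => ?_
  rw [tsum_fintype, cauchyProd, Finset.sum_mul, Finset.sum_div, ← Finset.sum_coe_sort (Finset.HasAntidiagonal.antidiagonal n)]
  refine Finset.sum_congr rfl fun p _ => ?_
  obtain ⟨⟨i, j⟩, hp⟩ := p
  have hp' : i + j = n := Finset.HasAntidiagonal.mem_antidiagonal.1 hp
  simp only [Function.comp_apply, Finset.HasAntidiagonal.sigmaAntidiagonalEquivProd_apply, hp']
  ring

theorem geomBounded_geometric (m q : ℝ) : GeomBounded fun k => m * q ^ k :=
  ⟨|m|, |q|, abs_nonneg _, abs_nonneg _, fun k => by rw [abs_mul, abs_pow]⟩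

theorem fracSeries_single {a b t : ℝ} (m : ℝ) :
    fracSeries (Pi.single 0 m) a b t = t ^ (b - 1) * (m / Real.Gamma b) := by
  rw [fracSeries, gammaSeries, tsum_eq_single 0 fun k hk => by simp [hk]]
  simp

theorem geomBounded_single (m : ℝ) : GeomBounded (Pi.single 0 m) := by
  refine ⟨|m|, 1, abs_nonneg _, zero_le_one, fun k => ?_⟩
  rcases eq_or_ne k 0 with rfl | hk
  · simp
  · simp [hk]

theorem cauchyProd_single (c : ℕ → ℝ) (m : ℝ) :
    cauchyProd c (Pi.single 0 m) = fun n => c n * m := by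
  ext n
  rw [cauchyProd, Finset.sum_eq_single (n, 0)]
  · simp
  · rintro ⟨i, j⟩ hp hne
    have hp' : i + j = n := Finset.HasAntidiagonal.mem_antidiagonal.1 hp
    have : j ≠ 0 := by rintro rfl; exact hne (by simpa using hp')
    simp [this]
  · intro h
    exact absurd (Finset.HasAntidiagonal.mem_antidiagonal.2 (by simp)) h

theorem cauchyProd_geometric (m m' q : ℝ) :
    cauchyProd (fun k => m * q ^ k) (fun k => m' * q ^ k) =
      fun n : ℕ => m * m' * (((n : ℝ) + 1) * q ^ n) := by
  ext n
  rw [cauchyProd, Finset.sum_congr rfl (g := fun _ => m * m' * q ^ n), Finset.sum_const,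
    Finset.Nat.card_antidiagonal]
  · simp; ring
  · rintro ⟨i, j⟩ hp
    have hp' : i + j = n := Finset.HasAntidiagonal.mem_antidiagonal.1 hp
    simp only
    rw [← hp', pow_add]; ring

theorem fracSeries_const_mul (m : ℝ) (c : ℕ → ℝ) (a b t : ℝ) :
    fracSeries (fun k => m * c k) a b t = m * fracSeries c a b t := by
  rw [fracSeries, fracSeries, gammaSeries, gammaSeries, mul_left_comm, ← tsum_mul_left (a := m)]
  congr 2 with k
  ring

theorem geomBounded_cauchyProd_geometric (m m' q : ℝ) :
    GeomBounded (cauchyProd (fun k => m * q ^ k) (fun k => m' * q ^ k)) := by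
  rw [cauchyProd_geometric]
  refine ⟨|m * m'|, 2 * |q|, abs_nonneg _, by positivity, fun k => ?_⟩
  rw [abs_mul (m * m'), abs_mul _ (q ^ k), mul_pow, abs_pow,
    abs_of_nonneg (by positivity : (0:ℝ) ≤ (k : ℝ) + 1)]
  have h1 : (k : ℝ) + 1 ≤ 2 ^ k := by exact_mod_cast Nat.lt_two_pow_self
  gcongr

/-- Fractional integration of a fractional power series. -/
theorem integral_fracSeries_mul_rpow {c : ℕ → ℝ} (hc : GeomBounded c) {a b β t : ℝ} (ha : 0 < a)
    (hb : 0 < b) (hβ : 0 < β) (ht : 0 < t) :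
    ∫ τ in (0:ℝ)..t, fracSeries c a b τ * (t - τ) ^ (β - 1) =
      Real.Gamma β * fracSeries c a (b + β) t := by
  have hΓ := Real.Gamma_pos_of_pos hβ
  have h := integral_fracSeries_mul_fracSeries hc (geomBounded_single (Real.Gamma β)) ha hb hβ ht
  simp only [fracSeries_single, div_self hΓ.ne', mul_one, cauchyProd_single] at h
  rw [h, ← fracSeries_const_mul]
  simp only [mul_comm]

theorem intervalIntegrable_fracSeries_mul_rpow {c : ℕ → ℝ} (hc : GeomBounded c) {a b β t : ℝ}
    (ha : 0 < a) (hb : 0 < b) (hβ : 0 < β) (ht : 0 < t) :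
    IntervalIntegrable (fun τ => fracSeries c a b τ * (t - τ) ^ (β - 1)) volume 0 t := by
  have h1 : ContinuousOn (fun τ : ℝ => gammaSeries c a b (τ ^ a)) (Set.uIcc 0 t) :=
    ((differentiable_gammaSeries hc ha hb).continuous.comp
      (Real.continuous_rpow_const ha.le)).continuousOn
  refine ((intervalIntegrable_rpow_mul_sub_rpow hb hβ ht).mul_continuousOn h1).congr ?_
  intro τ _
  simp only [fracSeries]
  ring

theorem fracSeries_eq_add {c : ℕ → ℝ} (hc : GeomBounded c) {a b t : ℝ} (ha : 0 < a)
    (hb : 0 < b) (ht : 0 < t) :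
    fracSeries c a b t = c 0 * (t ^ (b - 1) / Real.Gamma b) +
      fracSeries (fun k => c (k + 1)) a (b + a) t := by
  rw [fracSeries, fracSeries, gammaSeries, gammaSeries,
    (hc.summable ha hb (t ^ a)).of_norm.tsum_eq_zero_add,
    show b + a - 1 = (b - 1) + a by ring, Real.rpow_add ht, mul_assoc, ← tsum_mul_left, mul_add]
  congr 1
  · simp; ring
  · congr 2 with k
    rw [show ((k + 1 : ℕ) : ℝ) * a + b = (k : ℝ) * a + (b + a) by push_cast; ring, pow_succ]
    ring

/-- The function `lam t^(a-1) E_{a,a}(-lam t^a)`. -/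
noncomputable def mlKernel (lam a : ℝ) : ℝ → ℝ := fracSeries (fun k => lam * (-lam) ^ k) a a

theorem mlKernel_add_integral {lam a β t : ℝ} (ha : 0 < a) (hβ : 0 < β) (ht : 0 < t) :
    fracSeries (fun k => lam * (-lam) ^ k) a β t = lam * (t ^ (β - 1) / Real.Gamma β) -
      lam / Real.Gamma β * ∫ τ in (0:ℝ)..t, mlKernel lam a τ * (t - τ) ^ (β - 1) := by
  have hΓ := Real.Gamma_pos_of_pos hβ
  rw [mlKernel, integral_fracSeries_mul_rpow (geomBounded_geometric _ _) ha ha hβ ht,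
    fracSeries_eq_add (geomBounded_geometric _ _) ha hβ ht]
  have : (fun k : ℕ => lam * (-lam) ^ (k + 1)) = fun k => -lam * (lam * (-lam) ^ k) := by
    ext k; ring
  rw [this, fracSeries_const_mul, add_comm β a]
  field_simp
  ring

theorem mlKernel_volterra {lam a t : ℝ} (ha : 0 < a) (ht : 0 < t) :
    mlKernel lam a t = lam / Real.Gamma a *
      (t ^ (a - 1) - ∫ τ in (0:ℝ)..t, mlKernel lam a τ * (t - τ) ^ (a - 1)) := by
  conv_lhs => rw [mlKernel, mlKernel_add_integral ha ha ht]
  ring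

theorem rpow_sub_rpow_lower_bound {a t₀ t τ : ℝ} (ha0 : 0 < a) (ha1 : a < 1) (hτ : 0 < τ)
    (hτt : τ < t₀) (ht : t₀ < t) :
    (1 - a) * ((t - t₀) / t₀) * t ^ (a - 2) * τ ≤
      t ^ (a - 1) / t₀ ^ (a - 1) * (t₀ - τ) ^ (a - 1) - (t - τ) ^ (a - 1) := by
  have ht₀ : 0 < t₀ := hτ.trans hτt
  have ht0 : 0 < t := ht₀.trans ht
  have hd : 0 < t₀ - τ := by linarith
  set y := t - τ with hy
  have hy0 : 0 < y := by linarith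
  set u := t * (t₀ - τ) / t₀ / y with hu
  have hu0 : 0 < u := by positivity
  have huy : u * y = t - τ * t / t₀ := by rw [hu]; field_simp
  have hyx : (1 - u) * y = τ * (t - t₀) / t₀ := by rw [sub_mul, huy, hy]; field_simp; ring
  have hu1 : 0 ≤ 1 - u := by
    have : 0 ≤ (1 - u) * y := by
      rw [hyx]; exact div_nonneg (mul_nonneg hτ.le (by linarith)) ht₀.le
    exact nonneg_of_mul_nonneg_left this hy0
  have h1 : t ^ (a - 1) / t₀ ^ (a - 1) * (t₀ - τ) ^ (a - 1) = u ^ (a - 1) * y ^ (a - 1) := by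
    rw [← Real.mul_rpow hu0.le hy0.le, ← Real.div_rpow ht0.le ht₀.le,
      ← Real.mul_rpow (by positivity) hd.le]
    congr 1
    rw [hu]; field_simp
  set w := (1 - a) * (1 - u) with hw
  have hw0 : 0 ≤ w := mul_nonneg (by linarith) hu1
  have hup : u ^ (1 - a) ≤ 1 - w := by
    have := _root_.rpow_one_add_le_one_add_mul_self (s := u - 1) (by linarith) (p := 1 - a)
      (by linarith) (by linarith)
    rw [show 1 + (u - 1) = u by ring] at this
    rw [hw]; linarith
  have hup0 : 0 < u ^ (1 - a) := by positivity
  have hinv : 1 + w ≤ u ^ (a - 1) := by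
    rw [show a - 1 = -(1 - a) by ring, Real.rpow_neg hu0.le, le_inv_comm₀ (by linarith) hup0]
    refine hup.trans ?_
    rw [← one_div, le_div_iff₀ (by linarith)]
    nlinarith
  have hyt : t ^ (a - 2) ≤ y ^ (a - 2) :=
    Real.rpow_le_rpow_of_nonpos hy0 (by linarith) (by linarith)
  have hy1 : y ^ (a - 1) = y ^ (a - 2) * y := by
    rw [← Real.rpow_add_one hy0.ne']; ring_nf
  have hya : 0 < y ^ (a - 1) := by positivity
  calc (1 - a) * ((t - t₀) / t₀) * t ^ (a - 2) * τ
      = (1 - a) * (τ * (t - t₀) / t₀) * t ^ (a - 2) := by ring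
    _ ≤ (1 - a) * (τ * (t - t₀) / t₀) * y ^ (a - 2) := by
        refine mul_le_mul_of_nonneg_left hyt (mul_nonneg (by linarith) ?_)
        exact div_nonneg (mul_nonneg hτ.le (by linarith)) ht₀.le
    _ = w * y ^ (a - 1) := by rw [← hyx, hw, hy1]; ring
    _ ≤ (u ^ (a - 1) - 1) * y ^ (a - 1) := by gcongr; linarith
    _ = _ := by rw [h1]; ring

theorem mlKernel_pos_near_zero {lam a : ℝ} (hlam : 0 < lam) (ha : 0 < a) :
    ∃ ε > 0, ∀ t, 0 < t → t < ε → 0 < mlKernel lam a t := by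
  have hcont : Continuous fun t : ℝ => gammaSeries (fun k => lam * (-lam) ^ k) a a (t ^ a) :=
    (differentiable_gammaSeries (geomBounded_geometric _ _) ha ha).continuous.comp
      (Real.continuous_rpow_const ha.le)
  have h0 : 0 < gammaSeries (fun k => lam * (-lam) ^ k) a a ((0 : ℝ) ^ a) := by
    rw [Real.zero_rpow ha.ne', gammaSeries, tsum_eq_single 0 fun k hk => by simp [hk]]
    have := Real.Gamma_pos_of_pos ha
    simp only [pow_zero, mul_one, Nat.cast_zero, zero_mul, zero_add]
    positivity
  obtain ⟨ε, hε, h⟩ := Metric.eventually_nhds_iff.1 (hcont.continuousAt.eventually_const_lt h0)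
  refine ⟨ε, hε, fun t ht htε => ?_⟩
  have := h (y := t) (by rwa [Real.dist_eq, sub_zero, abs_of_pos ht])
  rw [mlKernel, fracSeries]
  positivity

theorem mlKernel_nonneg {lam a : ℝ} (hlam : 0 < lam) (ha0 : 0 < a) (ha1 : a < 1) {t : ℝ}
    (ht : 0 < t) : 0 ≤ mlKernel lam a t := by
  by_contra! hneg
  set r := mlKernel lam a with hr
  have hgb : GeomBounded fun k => lam * (-lam) ^ k := geomBounded_geometric _ _
  have hdiff : ∀ x, 0 < x → DifferentiableAt ℝ r x := fun x hx =>
    differentiableAt_fracSeries hgb ha0 ha0 hx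
  obtain ⟨ε, hε, hpos⟩ := mlKernel_pos_near_zero hlam ha0
  set S : Set ℝ := {x | 0 < x ∧ r x < 0} with hS
  have hSne : S.Nonempty := ⟨t, ht, hneg⟩
  have hSε : ∀ x ∈ S, ε ≤ x := fun x hx => by
    by_contra! h
    exact absurd (hpos x hx.1 h) (not_lt.2 hx.2.le)
  have hSbdd : BddBelow S := ⟨ε, hSε⟩
  set t₀ := sInf S with ht₀
  have hεt₀ : ε ≤ t₀ := le_csInf hSne hSε
  have ht₀0 : 0 < t₀ := hε.trans_le hεt₀
  have hbefore : ∀ x, 0 < x → x < t₀ → 0 ≤ r x := fun x hx hxt => by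
    by_contra! h
    exact absurd (csInf_le hSbdd ⟨hx, h⟩) (not_le.2 hxt)
  have hclose : ∀ δ > 0, ∃ x ∈ S, t₀ ≤ x ∧ x < t₀ + δ := fun δ hδ => by
    obtain ⟨x, hx, hxδ⟩ := exists_lt_of_csInf_lt hSne (lt_add_of_pos_right t₀ hδ)
    exact ⟨x, hx, csInf_le hSbdd hx, hxδ⟩
  have hct := (hdiff t₀ ht₀0).continuousAt
  have hrt₀ : r t₀ = 0 := by
    refine le_antisymm ?_ ?_
    · by_contra! h
      obtain ⟨δ, hδ, hδ'⟩ := Metric.eventually_nhds_iff.1 (hct.eventually_const_lt h)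
      obtain ⟨x, hx, hx1, hx2⟩ := hclose δ hδ
      have := hδ' (y := x) (by rw [Real.dist_eq, abs_lt]; constructor <;> linarith)
      exact absurd this (not_lt.2 hx.2.le)
    · by_contra! h
      obtain ⟨δ, hδ, hδ'⟩ := Metric.eventually_nhds_iff.1 (hct.eventually_lt_const h)
      have hm : 0 < min (δ / 2) (t₀ / 2) := by positivity
      have h1 := min_le_left (δ / 2) (t₀ / 2)
      have h2 := min_le_right (δ / 2) (t₀ / 2)
      have := hδ' (y := t₀ - min (δ / 2) (t₀ / 2))
        (by rw [Real.dist_eq, abs_lt]; constructor <;> linarith)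
      exact absurd (hbefore _ (by linarith) (by linarith)) (not_le.2 this)
  obtain ⟨L, hL⟩ := (hdiff t₀ ht₀0).isBigO_sub.bound
  obtain ⟨δ₁, hδ₁, hLip⟩ := Metric.eventually_nhds_iff.1 hL
  have hII : IntervalIntegrable r volume 0 t₀ := intervalIntegrable_fracSeries hgb ha0 ha0 t₀
  have hIIm : IntervalIntegrable (fun τ => r τ * τ) volume 0 t₀ :=
    hII.mul_continuousOn continuousOn_id
  set m := ∫ τ in (0:ℝ)..t₀, r τ * τ with hm
  have hm0 : 0 < m := by
    have hi1 : IntervalIntegrable (fun τ => r τ * τ) volume 0 (ε / 2) :=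
      hIIm.mono_set (by rw [Set.uIcc_of_le (by linarith), Set.uIcc_of_le (by linarith)]; exact
        Set.Icc_subset_Icc le_rfl (by linarith))
    have hi2 : IntervalIntegrable (fun τ => r τ * τ) volume (ε / 2) t₀ :=
      hIIm.mono_set (by rw [Set.uIcc_of_le (by linarith), Set.uIcc_of_le (by linarith)]; exact
        Set.Icc_subset_Icc (by linarith) le_rfl)
    rw [hm, ← intervalIntegral.integral_add_adjacent_intervals hi1 hi2]
    refine add_pos_of_pos_of_nonneg ?_ ?_
    · refine intervalIntegral.intervalIntegral_pos_of_pos_on hi1 (fun x hx => ?_) (by linarith)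
      exact mul_pos (hpos x hx.1 (by linarith [hx.2])) hx.1
    · refine intervalIntegral.integral_nonneg (by linarith) fun x hx => ?_
      rcases hx.2.eq_or_lt with rfl | h
      · rw [hrt₀, zero_mul]
      · exact mul_nonneg (hbefore x (by linarith [hx.1]) h) (by linarith [hx.1])
  have hg : ContinuousAt (fun x : ℝ => (1 - a) * m * x ^ (a - 2) / t₀ - L * (x - t₀) ^ a / a) t₀ := by
    refine ContinuousAt.sub (ContinuousAt.div_const (ContinuousAt.mul continuousAt_const
      (Real.continuousAt_rpow_const _ _ (Or.inl ht₀0.ne'))) _) (ContinuousAt.div_const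
      (ContinuousAt.mul continuousAt_const ?_) _)
    exact (continuousAt_id.sub continuousAt_const).rpow_const (Or.inr ha0.le)
  have hg0 : 0 < (1 - a) * m * t₀ ^ (a - 2) / t₀ - L * (t₀ - t₀) ^ a / a := by
    rw [sub_self, Real.zero_rpow ha0.ne', mul_zero, zero_div, sub_zero]
    have : 0 < 1 - a := by linarith
    positivity
  obtain ⟨δ₂, hδ₂, hgpos⟩ := Metric.eventually_nhds_iff.1 (hg.eventually_const_lt hg0)
  obtain ⟨x, hx, hx1, hx2⟩ := hclose (min δ₁ δ₂) (lt_min hδ₁ hδ₂)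
  have hxδ₁ : x < t₀ + δ₁ := hx2.trans_le (by gcongr; exact min_le_left _ _)
  have hxδ₂ : x < t₀ + δ₂ := hx2.trans_le (by gcongr; exact min_le_right _ _)
  have hlt : t₀ < x := lt_of_le_of_ne hx1 (by rintro h; rw [← h] at hx; exact hx.2.ne hrt₀)
  have hΓ := Real.Gamma_pos_of_pos ha0
  have hx0 := hx.1
  have hJ : ∫ τ in (0:ℝ)..t₀, r τ * (t₀ - τ) ^ (a - 1) = t₀ ^ (a - 1) := by
    have h := mlKernel_volterra (lam := lam) ha0 ht₀0
    rw [← hr, hrt₀] at h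
    have : lam / Real.Gamma a ≠ 0 := by positivity
    have := (mul_eq_zero.1 h.symm).resolve_left this
    linarith
  have hJi : IntervalIntegrable (fun τ => r τ * (t₀ - τ) ^ (a - 1)) volume 0 t₀ :=
    intervalIntegrable_fracSeries_mul_rpow hgb ha0 ha0 ha0 ht₀0
  have hxi : IntervalIntegrable (fun τ => r τ * (x - τ) ^ (a - 1)) volume 0 x :=
    intervalIntegrable_fracSeries_mul_rpow hgb ha0 ha0 ha0 hx0
  have hxi1 : IntervalIntegrable (fun τ => r τ * (x - τ) ^ (a - 1)) volume 0 t₀ :=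
    hxi.mono_set (by rw [Set.uIcc_of_le ht₀0.le, Set.uIcc_of_le hx0.le]; exact
        Set.Icc_subset_Icc le_rfl hx1)
  have hxi2 : IntervalIntegrable (fun τ => r τ * (x - τ) ^ (a - 1)) volume t₀ x :=
    hxi.mono_set (by rw [Set.uIcc_of_le hx1, Set.uIcc_of_le hx0.le]; exact
        Set.Icc_subset_Icc ht₀0.le le_rfl)
  have hI1 : (1 - a) * ((x - t₀) / t₀) * x ^ (a - 2) * m ≤
      x ^ (a - 1) - ∫ τ in (0:ℝ)..t₀, r τ * (x - τ) ^ (a - 1) := by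
    have e1 : x ^ (a - 1) = ∫ τ in (0:ℝ)..t₀,
        x ^ (a - 1) / t₀ ^ (a - 1) * (r τ * (t₀ - τ) ^ (a - 1)) := by
      have : 0 < t₀ ^ (a - 1) := by positivity
      rw [intervalIntegral.integral_const_mul, hJ]; field_simp
    conv_rhs => rw [e1]
    rw [← intervalIntegral.integral_sub (hJi.const_mul _) hxi1, hm,
      ← intervalIntegral.integral_const_mul]
    refine intervalIntegral.integral_mono_on_of_le_Ioo ht₀0.le (hIIm.const_mul _)
      ((hJi.const_mul _).sub hxi1) fun τ hτ => ?_
    have := mul_le_mul_of_nonneg_left (rpow_sub_rpow_lower_bound ha0 ha1 hτ.1 hτ.2 hlt)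
      (hbefore τ hτ.1 hτ.2)
    linarith
  have hI2 : ∫ τ in t₀..x, r τ * (x - τ) ^ (a - 1) ≤ (x - t₀) * (L * (x - t₀) ^ a / a) := by
    have hki : IntervalIntegrable (fun τ => (x - τ) ^ (a - 1)) volume t₀ x := by
      have := (intervalIntegral.intervalIntegrable_rpow' (a := x - t₀) (b := 0)
        (show -1 < a - 1 by linarith)).comp_sub_left x
      simpa using this
    have hkv : ∫ τ in t₀..x, (x - τ) ^ (a - 1) = (x - t₀) ^ a / a := by
      rw [intervalIntegral.integral_comp_sub_left (fun y => y ^ (a - 1)), sub_self,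
        integral_rpow (Or.inl (by linarith))]
      simp [Real.zero_rpow ha0.ne']
    calc ∫ τ in t₀..x, r τ * (x - τ) ^ (a - 1)
        ≤ ∫ τ in t₀..x, (L * (x - t₀)) * (x - τ) ^ (a - 1) := by
          refine intervalIntegral.integral_mono_on hx1 hxi2 (hki.const_mul _) fun τ hτ => ?_
          have h1 : ‖r τ - r t₀‖ ≤ L * ‖τ - t₀‖ := hLip (by
            rw [Real.dist_eq, abs_lt]; constructor <;> linarith [hτ.1, hτ.2])
          have h2 : ‖r x - r t₀‖ ≤ L * ‖x - t₀‖ := hLip (by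
            rw [Real.dist_eq, abs_lt]; constructor <;> linarith)
          rw [hrt₀, sub_zero, Real.norm_of_nonneg (sub_nonneg.2 hτ.1)] at h1
          rw [Real.norm_of_nonneg (sub_nonneg.2 hx1)] at h2
          have hL0 : 0 ≤ L :=
            nonneg_of_mul_nonneg_left ((norm_nonneg _).trans h2) (sub_pos.2 hlt)
          have h3 : 0 ≤ x - τ := by linarith [hτ.2]
          gcongr
          refine (Real.le_norm_self _).trans (h1.trans ?_)
          gcongr
          exact hτ.2
      _ = _ := by rw [intervalIntegral.integral_const_mul, hkv]; ring
  have hfin := mlKernel_volterra (lam := lam) ha0 hx0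
  rw [← hr, ← intervalIntegral.integral_add_adjacent_intervals hxi1 hxi2] at hfin
  have hgx := hgpos (y := x) (by rw [Real.dist_eq, abs_lt]; constructor <;> linarith)
  have hprod : 0 < (x - t₀) * ((1 - a) * m * x ^ (a - 2) / t₀ - L * (x - t₀) ^ a / a) :=
    mul_pos (by linarith) hgx
  have hring : (1 - a) * ((x - t₀) / t₀) * x ^ (a - 2) * m =
    (x - t₀) * ((1 - a) * m * x ^ (a - 2) / t₀) := by ring
  have : 0 < r x := by
    rw [hfin]
    refine mul_pos (by positivity) ?_
    linarith
  exact absurd this (not_lt.2 hx.2.le)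

theorem integral_mul_sub_rpow_eq_integral_Ioi (ρ : ℝ → ℝ) {β t : ℝ} (hβ : 0 < β) (ht : 0 ≤ t) :
    ∫ τ in (0:ℝ)..t, ρ τ * (t - τ) ^ β = ∫ τ in Set.Ioi (0:ℝ), ρ τ * (max (t - τ) 0) ^ β := by
  rw [intervalIntegral.integral_of_le ht]
  refine Eq.trans ?_ (setIntegral_eq_of_subset_of_forall_sdiff_eq_zero
    (measurableSet_Ioi : MeasurableSet (Set.Ioi (0:ℝ))) (s := Set.Ioc 0 t) (fun τ hτ => hτ.1) ?_).symm
  · refine setIntegral_congr_fun measurableSet_Ioc fun τ hτ => ?_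
    rw [max_eq_left (by linarith [hτ.2])]
  · rintro τ ⟨h0, h1⟩
    have h2 : t < τ := by
      by_contra! h
      exact h1 ⟨h0, h⟩
    rw [max_eq_right (by linarith), Real.zero_rpow hβ.ne', mul_zero]

theorem tendsto_integral_mul_sub_rpow_div {ρ : ℝ → ℝ} (hρ : IntegrableOn ρ (Set.Ioi 0)) {β : ℝ}
    (hβ : 0 < β) :
    Tendsto (fun t => (∫ τ in (0:ℝ)..t, ρ τ * (t - τ) ^ β) / t ^ β) atTop
      (𝓝 (∫ τ in Set.Ioi (0:ℝ), ρ τ)) := by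
  have key : Tendsto (fun t : ℝ => ∫ τ in Set.Ioi (0:ℝ), ρ τ * (max (t - τ) 0 / t) ^ β) atTop
      (𝓝 (∫ τ in Set.Ioi (0:ℝ), ρ τ)) := by
    refine tendsto_integral_filter_of_dominated_convergence (fun τ => ‖ρ τ‖) ?_ ?_ hρ.norm ?_
    · refine Eventually.of_forall fun t => hρ.aestronglyMeasurable.mul ?_
      exact Measurable.aestronglyMeasurable (by fun_prop)
    · filter_upwards [eventually_gt_atTop 0] with t ht
      filter_upwards [ae_restrict_mem measurableSet_Ioi] with τ hτ
      have hτ' : (0:ℝ) < τ := hτ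
      have h0 : 0 ≤ max (t - τ) 0 / t := div_nonneg (le_max_right _ _) ht.le
      rw [norm_mul, Real.norm_of_nonneg (Real.rpow_nonneg h0 _)]
      refine mul_le_of_le_one_right (norm_nonneg _) (Real.rpow_le_one h0 ?_ hβ.le)
      rw [div_le_one ht]
      exact max_le (by linarith) ht.le
    · refine Eventually.of_forall fun τ => ?_
      have h1 : Tendsto (fun t : ℝ => max (t - τ) 0 / t) atTop (𝓝 1) := by
        have h2 : Tendsto (fun t : ℝ => 1 - τ / t) atTop (𝓝 (1 - 0)) :=
          tendsto_const_nhds.sub (tendsto_const_nhds.div_atTop tendsto_id)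
        rw [sub_zero] at h2
        refine h2.congr' ?_
        filter_upwards [eventually_gt_atTop 0, eventually_ge_atTop τ] with t ht htτ
        rw [max_eq_left (by linarith)]
        field_simp
      have h3 := (h1.rpow_const (p := β) (Or.inl one_ne_zero)).const_mul (ρ τ)
      simpa using h3
  refine key.congr' ?_
  filter_upwards [eventually_gt_atTop 0] with t ht
  rw [integral_mul_sub_rpow_eq_integral_Ioi ρ hβ ht.le, ← integral_div]
  refine integral_congr_ae (Eventually.of_forall fun τ => ?_)
  simp only
  rw [Real.div_rpow (le_max_right _ _) ht.le, mul_div_assoc]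

theorem intervalIntegrable_mlKernel {lam a : ℝ} (ha : 0 < a) (t : ℝ) :
    IntervalIntegrable (mlKernel lam a) volume 0 t :=
  intervalIntegrable_fracSeries (geomBounded_geometric _ _) ha ha t

theorem integral_mlKernel_le_one {lam a t : ℝ} (hlam : 0 < lam) (ha0 : 0 < a) (ha1 : a < 1)
    (ht : 0 < t) : ∫ τ in (0:ℝ)..t, mlKernel lam a τ ≤ 1 := by
  have hΓ := Real.Gamma_pos_of_pos ha0
  have h0 := mlKernel_nonneg hlam ha0 ha1 ht
  rw [mlKernel_volterra ha0 ht] at h0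
  have h1 : ∫ τ in (0:ℝ)..t, mlKernel lam a τ * (t - τ) ^ (a - 1) ≤ t ^ (a - 1) :=
    sub_nonneg.1 (nonneg_of_mul_nonneg_right h0 (by positivity))
  have h2 : (∫ τ in (0:ℝ)..t, mlKernel lam a τ * t ^ (a - 1)) ≤
      ∫ τ in (0:ℝ)..t, mlKernel lam a τ * (t - τ) ^ (a - 1) := by
    refine intervalIntegral.integral_mono_on_of_le_Ioo ht.le
      ((intervalIntegrable_mlKernel ha0 t).mul_const _)
      (intervalIntegrable_fracSeries_mul_rpow (geomBounded_geometric _ _) ha0 ha0 ha0 ht) ?_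
    intro τ hτ
    refine mul_le_mul_of_nonneg_left ?_ (mlKernel_nonneg hlam ha0 ha1 hτ.1)
    exact Real.rpow_le_rpow_of_nonpos (by linarith [hτ.2]) (by linarith [hτ.1]) (by linarith)
  rw [intervalIntegral.integral_mul_const] at h2
  have hp : 0 < t ^ (a - 1) := by positivity
  nlinarith

theorem integrableOn_mlKernel {lam a : ℝ} (hlam : 0 < lam) (ha0 : 0 < a) (ha1 : a < 1) :
    IntegrableOn (mlKernel lam a) (Set.Ioi 0) := by
  refine integrableOn_Ioi_of_intervalIntegral_norm_bounded (l := atTop) (b := id) 1 0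
    (fun t => ?_) tendsto_id ?_
  · rcases le_total 0 t with ht | ht
    · exact (intervalIntegrable_iff_integrableOn_Ioc_of_le ht).1 (intervalIntegrable_mlKernel ha0 t)
    · simp [Set.Ioc_eq_empty_of_le ht]
  · filter_upwards [eventually_gt_atTop 0] with t ht
    refine le_trans (le_of_eq ?_) (integral_mlKernel_le_one hlam ha0 ha1 ht)
    refine intervalIntegral.integral_congr_ae (Eventually.of_forall fun τ hτ => ?_)
    simp only [id, Set.uIoc_of_le ht.le] at hτ
    exact Real.norm_of_nonneg (mlKernel_nonneg hlam ha0 ha1 hτ.1)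

theorem integral_Ioi_mlKernel {lam a : ℝ} (hlam : 0 < lam) (ha0 : 0 < a) (ha1 : a < 1) :
    ∫ τ in Set.Ioi (0:ℝ), mlKernel lam a τ = 1 := by
  have hi := integrableOn_mlKernel hlam ha0 ha1
  have hΓ := Real.Gamma_pos_of_pos (show 0 < a + 1 by linarith)
  refine tendsto_nhds_unique (tendsto_integral_mul_sub_rpow_div hi ha0) ?_
  have hR := intervalIntegral_tendsto_integral_Ioi 0 hi tendsto_id
  have h1 : Tendsto (fun t : ℝ => 1 - Real.Gamma (a + 1) / lam *
      ((∫ τ in (0:ℝ)..t, mlKernel lam a τ) * t ^ (-a))) atTop (𝓝 (1 - Real.Gamma (a + 1) / lam *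
      ((∫ τ in Set.Ioi (0:ℝ), mlKernel lam a τ) * 0))) :=
    ((hR.mul (tendsto_rpow_neg_atTop ha0)).const_mul _).const_sub _
  simp only [mul_zero, sub_zero] at h1
  refine h1.congr' ?_
  filter_upwards [eventually_gt_atTop 0] with t ht
  have h2 := mlKernel_add_integral (lam := lam) (β := a + 1) ha0 (by linarith) ht
  have h3 := integral_fracSeries_mul_rpow (geomBounded_geometric lam (-lam)) ha0 ha0 one_pos ht
  simp only [sub_self, Real.rpow_zero, mul_one, Real.Gamma_one, one_mul] at h3
  rw [← h3, add_sub_cancel_right] at h2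
  change (∫ τ in (0:ℝ)..t, mlKernel lam a τ) = _ at h2
  have hp : 0 < t ^ a := by positivity
  rw [h2, Real.rpow_neg ht.le]
  field_simp
  ring

/-- The convolution square of `mlKernel lam a` on the half-line. -/
noncomputable def mlKernelSq (lam a : ℝ) : ℝ → ℝ :=
  fracSeries (cauchyProd (fun k => lam * (-lam) ^ k) fun k => lam * (-lam) ^ k) a (a + a)

theorem integral_mlKernel_mul_mlKernel {lam a t : ℝ} (ha : 0 < a) (ht : 0 < t) :
    ∫ τ in (0:ℝ)..t, mlKernel lam a τ * mlKernel lam a (t - τ) = mlKernelSq lam a t :=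
  integral_fracSeries_mul_fracSeries (geomBounded_geometric _ _) (geomBounded_geometric _ _)
    ha ha ha ht

theorem integrableOn_mlKernelSq {lam a : ℝ} (hlam : 0 < lam) (ha0 : 0 < a) (ha1 : a < 1) :
    IntegrableOn (mlKernelSq lam a) (Set.Ioi 0) := by
  have hi := integrableOn_mlKernel hlam ha0 ha1
  have h := integrable_posConvolution hi hi (ContinuousLinearMap.mul ℝ ℝ)
  refine h.integrableOn.congr_fun (fun t ht => ?_) measurableSet_Ioi
  rw [posConvolution, Set.indicator_of_mem ht]
  exact integral_mlKernel_mul_mlKernel ha0 ht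

theorem integral_Ioi_mlKernelSq {lam a : ℝ} (hlam : 0 < lam) (ha0 : 0 < a) (ha1 : a < 1) :
    ∫ τ in Set.Ioi (0:ℝ), mlKernelSq lam a τ = 1 := by
  have hi := integrableOn_mlKernel hlam ha0 ha1
  have h := integral_posConvolution hi hi (ContinuousLinearMap.mul ℝ ℝ)
  rw [integral_Ioi_mlKernel hlam ha0 ha1] at h
  simp only [ContinuousLinearMap.mul_apply', mul_one] at h
  rw [← h]
  exact setIntegral_congr_fun measurableSet_Ioi fun t ht =>
    (integral_mlKernel_mul_mlKernel ha0 ht).symm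

theorem Ufun_eq_fracSeries (a1 a2 C1 C2 t : ℝ) :
    Ufun a1 a2 C1 C2 t = fracSeries (fun k => 1 / C1 * (-C2 / C1) ^ k) (a1 - a2) (a1 + 1) t := by
  rw [fracSeries_const_mul, fracSeries, gammaSeries, Ufun, ML, add_sub_cancel_right,
    mul_div_right_comm (-C2)]
  simp only [mul_pow]
  ring

theorem ufun_eq_fracSeries (a1 a2 C1 C2 t : ℝ) :
    ufun a1 a2 C1 C2 t = fracSeries (fun k => 1 / C1 * (-C2 / C1) ^ k) (a1 - a2) a1 t := by
  rw [fracSeries_const_mul, fracSeries, gammaSeries, ufun, ML, mul_div_right_comm (-C2)]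
  simp only [mul_pow]
  ring

theorem continuous_Ufun {a1 a2 C1 C2 : ℝ} (ha1 : 0 < a1) (ha : a2 < a1) :
    Continuous (Ufun a1 a2 C1 C2) := by
  rw [funext (Ufun_eq_fracSeries a1 a2 C1 C2)]
  exact continuous_fracSeries (geomBounded_geometric _ _) (sub_pos.2 ha) (by linarith)

theorem intervalIntegrable_ufun {a1 a2 C1 C2 : ℝ} (ha1 : 0 < a1) (ha : a2 < a1) (t : ℝ) :
    IntervalIntegrable (ufun a1 a2 C1 C2) volume 0 t := by
  rw [funext (ufun_eq_fracSeries a1 a2 C1 C2)]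
  exact intervalIntegrable_fracSeries (geomBounded_geometric _ _) (sub_pos.2 ha) ha1 t

theorem integral_ufun {a1 a2 C1 C2 t : ℝ} (ha1 : 0 < a1) (ha : a2 < a1) (ht : 0 < t) :
    ∫ τ in (0:ℝ)..t, ufun a1 a2 C1 C2 τ = Ufun a1 a2 C1 C2 t := by
  have h := integral_fracSeries_mul_rpow (geomBounded_geometric (1 / C1) (-C2 / C1))
    (sub_pos.2 ha) ha1 one_pos ht
  simp only [sub_self, Real.rpow_zero, mul_one, Real.Gamma_one, one_mul] at h
  simpa only [Ufun_eq_fracSeries, ufun_eq_fracSeries] using h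

theorem Ufun_eq_integral_mlKernel {a1 a2 C1 C2 t : ℝ} (ha2 : 0 < a2) (ha : a2 < a1)
    (hC2 : 0 < C2) (ht : 0 < t) :
    Ufun a1 a2 C1 C2 t = 1 / (C2 * Real.Gamma (a2 + 1)) *
      ∫ τ in (0:ℝ)..t, mlKernel (C2 / C1) (a1 - a2) τ * (t - τ) ^ a2 := by
  have hΓ := Real.Gamma_pos_of_pos (show 0 < a2 + 1 by linarith)
  have h := integral_fracSeries_mul_rpow (geomBounded_geometric (C2 / C1) (-(C2 / C1)))
    (sub_pos.2 ha) (sub_pos.2 ha) (show 0 < a2 + 1 by linarith) ht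
  rw [add_sub_cancel_right, show a1 - a2 + (a2 + 1) = a1 + 1 by ring] at h
  rw [mlKernel, h, Ufun_eq_fracSeries, fracSeries_const_mul, fracSeries_const_mul, neg_div]
  field_simp

theorem Ifun_self_eq_fracSeries {a1 a2 C1 C2 t : ℝ} (ha1 : 0 < a1) (ha : a2 < a1) (ht : 0 < t) :
    Ifun a1 a2 C1 C2 t t = 1 / C1 ^ 2 *
      fracSeries (fun k : ℕ => ((k : ℝ) + 1) * (-C2 / C1) ^ k) (a1 - a2) (2 * a1 + 1) t := by
  have h := integral_fracSeries_mul_fracSeries (geomBounded_geometric (1 / C1) (-C2 / C1))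
    (geomBounded_geometric (1 / C1) (-C2 / C1)) (sub_pos.2 ha) ha1
    (show 0 < a1 + 1 by linarith) ht
  rw [cauchyProd_geometric, fracSeries_const_mul, ← add_assoc, ← two_mul, ← sq, div_pow,
    one_pow] at h
  rw [← h, Ifun]
  simp only [Ufun_eq_fracSeries, ufun_eq_fracSeries, mul_comm]

theorem Ifun_self_eq_ML2 {a1 a2 C1 C2 t : ℝ} (ha1 : 0 < a1) (ha : a2 < a1) (ht : 0 < t) :
    Ifun a1 a2 C1 C2 t t = t ^ (2 * a1) / C1 ^ 2 *
      ML2 (a1 - a2) (2 * a1 + 1) (-C2 * t ^ (a1 - a2) / C1) := by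
  rw [Ifun_self_eq_fracSeries ha1 ha ht, fracSeries, gammaSeries, ML2, add_sub_cancel_right,
    mul_div_right_comm (-C2)]
  simp only [mul_pow]
  rw [← mul_assoc, one_div_mul_eq_div]
  simp only [mul_assoc]

theorem Ifun_self_eq_integral_mlKernelSq {a1 a2 C1 C2 t : ℝ} (ha2 : 0 < a2) (ha : a2 < a1)
    (hC2 : 0 < C2) (ht : 0 < t) :
    Ifun a1 a2 C1 C2 t t = 1 / (C2 ^ 2 * Real.Gamma (2 * a2 + 1)) *
      ∫ τ in (0:ℝ)..t, mlKernelSq (C2 / C1) (a1 - a2) τ * (t - τ) ^ (2 * a2) := by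
  have hΓ := Real.Gamma_pos_of_pos (show 0 < 2 * a2 + 1 by linarith)
  have ha' := sub_pos.2 ha
  have h := integral_fracSeries_mul_rpow
    (geomBounded_cauchyProd_geometric (C2 / C1) (C2 / C1) (-(C2 / C1)))
    ha' (add_pos ha' ha') (show 0 < 2 * a2 + 1 by linarith) ht
  rw [add_sub_cancel_right, show a1 - a2 + (a1 - a2) + (2 * a2 + 1) = 2 * a1 + 1 by ring] at h
  rw [mlKernelSq, h, Ifun_self_eq_fracSeries (ha2.trans ha) ha ht, cauchyProd_geometric,
    fracSeries_const_mul, neg_div]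
  field_simp

theorem tendsto_Ufun_div {a1 a2 C1 C2 : ℝ} (ha2 : 0 < a2) (ha : a2 < a1) (ha1 : a1 < 1)
    (hC1 : 0 < C1) (hC2 : 0 < C2) :
    Tendsto (fun t => Ufun a1 a2 C1 C2 t / t ^ a2) atTop
      (𝓝 (1 / (C2 * Real.Gamma (a2 + 1)))) := by
  have hlam := div_pos hC2 hC1
  have h := (tendsto_integral_mul_sub_rpow_div (integrableOn_mlKernel hlam (sub_pos.2 ha)
    (by linarith)) ha2).const_mul (1 / (C2 * Real.Gamma (a2 + 1)))
  rw [integral_Ioi_mlKernel hlam (sub_pos.2 ha) (by linarith), mul_one] at h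
  refine h.congr' ?_
  filter_upwards [eventually_gt_atTop 0] with t ht
  rw [Ufun_eq_integral_mlKernel ha2 ha hC2 ht, mul_div_assoc]

theorem tendsto_Ifun_self_div {a1 a2 C1 C2 : ℝ} (ha2 : 0 < a2) (ha : a2 < a1) (ha1 : a1 < 1)
    (hC1 : 0 < C1) (hC2 : 0 < C2) :
    Tendsto (fun t => Ifun a1 a2 C1 C2 t t / t ^ (2 * a2)) atTop
      (𝓝 (1 / (C2 ^ 2 * Real.Gamma (2 * a2 + 1)))) := by
  have hlam := div_pos hC2 hC1
  have h := (tendsto_integral_mul_sub_rpow_div (integrableOn_mlKernelSq hlam (sub_pos.2 ha)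
    (by linarith)) (show 0 < 2 * a2 by linarith)).const_mul (1 / (C2 ^ 2 * Real.Gamma (2 * a2 + 1)))
  rw [integral_Ioi_mlKernelSq hlam (sub_pos.2 ha) (by linarith), mul_one] at h
  refine h.congr' ?_
  filter_upwards [eventually_gt_atTop 0] with t ht
  rw [Ifun_self_eq_integral_mlKernelSq ha2 ha hC2 ht, mul_div_assoc]

theorem intervalIntegrable_Ufun_sub_mul_ufun {a1 a2 C1 C2 : ℝ} (ha1 : 0 < a1) (ha : a2 < a1)
    (s t : ℝ) :
    IntervalIntegrable (fun τ => Ufun a1 a2 C1 C2 (t - τ) * ufun a1 a2 C1 C2 τ) volume 0 s :=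
  (intervalIntegrable_ufun ha1 ha s).continuousOn_mul
    ((continuous_Ufun ha1 ha).comp (continuous_const.sub continuous_id)).continuousOn

theorem CovY_eq {a1 a2 C1 C2 s t : ℝ} (ha1 : 0 < a1) (ha : a2 < a1) (hst : s ≤ t) :
    CovY a1 a2 C1 C2 s t = Ifun a1 a2 C1 C2 s s + Ifun a1 a2 C1 C2 s t -
      Ufun a1 a2 C1 C2 s * Ufun a1 a2 C1 C2 t := by
  rw [CovY, min_eq_left hst, Ifun, Ifun]
  simp only [add_mul]
  rw [intervalIntegral.integral_add (intervalIntegrable_Ufun_sub_mul_ufun ha1 ha s s)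
    (intervalIntegrable_Ufun_sub_mul_ufun ha1 ha s t)]

theorem tendsto_VarY_div {a1 a2 C1 C2 : ℝ} (ha2 : 0 < a2) (ha : a2 < a1) (ha1 : a1 < 1)
    (hC1 : 0 < C1) (hC2 : 0 < C2) :
    Tendsto (fun t => VarY a1 a2 C1 C2 t / t ^ (2 * a2)) atTop
      (𝓝 (1 / C2 ^ 2 * (2 / Real.Gamma (2 * a2 + 1) - 1 / Real.Gamma (a2 + 1) ^ 2))) := by
  have h := ((tendsto_Ifun_self_div ha2 ha ha1 hC1 hC2).const_mul 2).sub
    ((tendsto_Ufun_div ha2 ha ha1 hC1 hC2).pow 2)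
  have h1 := (Real.Gamma_pos_of_pos (show 0 < 2 * a2 + 1 by linarith)).ne'
  have h2 := (Real.Gamma_pos_of_pos (show 0 < a2 + 1 by linarith)).ne'
  convert h.congr' ?_ using 2
  · field_simp
  · filter_upwards [eventually_gt_atTop 0] with t ht
    rw [VarY, CovY_eq (ha2.trans ha) ha le_rfl, div_pow, ← Real.rpow_mul_natCast ht.le]
    push_cast
    rw [mul_comm a2 2]
    ring

theorem Gamma_two_mul_add_one_lt {a : ℝ} (ha0 : 0 < a) (ha1 : a < 1) :
    Real.Gamma (2 * a + 1) < 2 * Real.Gamma (a + 1) ^ 2 := by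
  have hΓ := Real.Gamma_pos_of_pos (show 0 < a + 1 by linarith)
  have h2 : Real.Gamma (a + 2) = (a + 1) * Real.Gamma (a + 1) := by
    rw [show a + 2 = a + 1 + 1 by ring, Real.Gamma_add_one (by linarith)]
  have e1 := Real.Gamma_mul_add_mul_le_rpow_Gamma_mul_rpow_Gamma (s := a + 1) (t := a + 2)
    (a := 1 - a) (b := a) (by linarith) (by linarith) (by linarith) ha0 (by ring)
  have e2 := Real.Gamma_mul_add_mul_le_rpow_Gamma_mul_rpow_Gamma (s := a + 1) (t := a + 2)
    (a := a) (b := 1 - a) (by linarith) (by linarith) ha0 (by linarith) (by ring)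
  rw [show (1 - a) * (a + 1) + a * (a + 2) = 2 * a + 1 by ring] at e1
  rw [show a * (a + 1) + (1 - a) * (a + 2) = 2 by ring, Real.Gamma_two] at e2
  have hpos := Real.Gamma_pos_of_pos (show 0 < 2 * a + 1 by linarith)
  have e3 := mul_le_mul e1 e2 zero_le_one (by rw [h2]; positivity)
  have e4 : Real.Gamma (a + 1) ^ (1 - a) * Real.Gamma (a + 2) ^ a *
      (Real.Gamma (a + 1) ^ a * Real.Gamma (a + 2) ^ (1 - a)) =
      Real.Gamma (a + 1) * Real.Gamma (a + 2) := by
    have h3 : 0 < Real.Gamma (a + 2) := by rw [h2]; positivity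
    calc _ = (Real.Gamma (a + 1) ^ (1 - a) * Real.Gamma (a + 1) ^ a) *
          (Real.Gamma (a + 2) ^ a * Real.Gamma (a + 2) ^ (1 - a)) := by ring
      _ = _ := by
        rw [← Real.rpow_add hΓ, ← Real.rpow_add h3]
        simp
  rw [e4, h2, mul_one] at e3
  have : 0 < (1 - a) * Real.Gamma (a + 1) ^ 2 := mul_pos (by linarith) (by positivity)
  nlinarith

theorem tendsto_rpow_sub_rpow_sub {β s : ℝ} (hβ0 : 0 < β) (hβ1 : β < 1) (hs : 0 ≤ s) :
    Tendsto (fun x : ℝ => x ^ β - (x - s) ^ β) atTop (𝓝 0) := by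
  have h : Tendsto (fun x : ℝ => s * x ^ (-(1 - β))) atTop (𝓝 (s * 0)) :=
    (tendsto_rpow_neg_atTop (by linarith)).const_mul s
  rw [mul_zero] at h
  refine squeeze_zero' ?_ ?_ h
  · filter_upwards [eventually_ge_atTop s] with x hx
    exact sub_nonneg.2 (Real.rpow_le_rpow (by linarith) (by linarith) hβ0.le)
  · filter_upwards [eventually_ge_atTop s, eventually_gt_atTop 0] with x hx hx0
    have h1 : 0 ≤ (x - s) / x := div_nonneg (by linarith) hx0.le
    have h2 : (x - s) / x ≤ ((x - s) / x) ^ β :=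
      Real.self_le_rpow_of_le_one h1 ((div_le_one hx0).2 (by linarith)) hβ1.le
    rw [Real.div_rpow (by linarith) hx0.le, div_le_div_iff₀ hx0 (by positivity)] at h2
    rw [neg_sub, Real.rpow_sub_one hx0.ne', mul_div_assoc', le_div_iff₀ hx0]
    nlinarith

theorem abs_max_rpow_sub_max_rpow_le {β s x : ℝ} (hβ0 : 0 < β) (hβ1 : β ≤ 1) (hs : 0 ≤ s) :
    |(max x 0) ^ β - (max (x - s) 0) ^ β| ≤ s ^ β := by
  have h0 : 0 ≤ max (x - s) 0 := le_max_right _ _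
  have h1 : max (x - s) 0 ≤ max x 0 := max_le_max (by linarith) le_rfl
  have h2 : max x 0 ≤ max (x - s) 0 + s :=
    max_le (by linarith [le_max_left (x - s) 0]) (by linarith)
  rw [abs_of_nonneg (sub_nonneg.2 (Real.rpow_le_rpow h0 h1 hβ0.le))]
  have h3 := Real.rpow_le_rpow (le_max_right x 0) h2 hβ0.le
  have h4 := Real.rpow_add_le_add_rpow h0 hs hβ0.le hβ1
  linarith

theorem integrableOn_mul_max_rpow {ρ : ℝ → ℝ} (hρ : IntegrableOn ρ (Set.Ioi 0)) {β : ℝ}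
    (hβ : 0 < β) (t : ℝ) :
    IntegrableOn (fun τ => ρ τ * (max (t - τ) 0) ^ β) (Set.Ioi 0) := by
  refine Integrable.mul_bdd (c := |t| ^ β) hρ (Measurable.aestronglyMeasurable (by fun_prop)) ?_
  filter_upwards [ae_restrict_mem measurableSet_Ioi] with τ hτ
  have hτ' : (0:ℝ) < τ := hτ
  rw [Real.norm_of_nonneg (Real.rpow_nonneg (le_max_right _ _) _)]
  exact Real.rpow_le_rpow (le_max_right _ _)
    (max_le (by linarith [le_abs_self t]) (abs_nonneg t)) hβ.le

theorem tendsto_integral_mul_max_rpow_sub {ρ : ℝ → ℝ} (hρ : IntegrableOn ρ (Set.Ioi 0)) {β s : ℝ}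
    (hβ0 : 0 < β) (hβ1 : β < 1) (hs : 0 ≤ s) :
    Tendsto (fun t => (∫ τ in Set.Ioi (0:ℝ), ρ τ * (max (t - τ) 0) ^ β) -
      ∫ τ in Set.Ioi (0:ℝ), ρ τ * (max (t - s - τ) 0) ^ β) atTop (𝓝 0) := by
  have key : Tendsto (fun t : ℝ => ∫ τ in Set.Ioi (0:ℝ),
      ρ τ * ((max (t - τ) 0) ^ β - (max (t - τ - s) 0) ^ β)) atTop
      (𝓝 (∫ τ in Set.Ioi (0:ℝ), ρ τ * 0)) := by
    refine tendsto_integral_filter_of_dominated_convergence (fun τ => ‖ρ τ‖ * s ^ β) ?_ ?_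
      (hρ.norm.mul_const _) ?_
    · refine Eventually.of_forall fun t => hρ.aestronglyMeasurable.mul ?_
      exact Measurable.aestronglyMeasurable (by fun_prop)
    · refine Eventually.of_forall fun t => Eventually.of_forall fun τ => ?_
      rw [norm_mul]
      exact mul_le_mul_of_nonneg_left (abs_max_rpow_sub_max_rpow_le hβ0 hβ1.le hs) (norm_nonneg _)
    · refine Eventually.of_forall fun τ => Tendsto.const_mul _ ?_
      refine ((tendsto_rpow_sub_rpow_sub hβ0 hβ1 hs).comp
        (tendsto_atTop_add_const_right atTop (-τ) tendsto_id)).congr' ?_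
      filter_upwards [eventually_ge_atTop (τ + s)] with t ht
      simp only [Function.comp_apply, id, ← sub_eq_add_neg]
      rw [max_eq_left (by linarith), max_eq_left (by linarith)]
  simp only [mul_zero, integral_zero] at key
  refine key.congr fun t => ?_
  rw [← integral_sub (integrableOn_mul_max_rpow hρ hβ0 t)
    (integrableOn_mul_max_rpow hρ hβ0 (t - s))]
  simp only [mul_sub, sub_right_comm t s]

theorem Ufun_eq_integral_Ioi {a1 a2 C1 C2 t : ℝ} (ha2 : 0 < a2) (ha : a2 < a1)
    (hC2 : 0 < C2) (ht : 0 < t) :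
    Ufun a1 a2 C1 C2 t = 1 / (C2 * Real.Gamma (a2 + 1)) *
      ∫ τ in Set.Ioi (0:ℝ), mlKernel (C2 / C1) (a1 - a2) τ * (max (t - τ) 0) ^ a2 := by
  rw [Ufun_eq_integral_mlKernel ha2 ha hC2 ht, integral_mul_sub_rpow_eq_integral_Ioi _ ha2 ht.le]

theorem monotoneOn_Ufun {a1 a2 C1 C2 : ℝ} (ha2 : 0 < a2) (ha : a2 < a1) (ha1 : a1 < 1)
    (hC1 : 0 < C1) (hC2 : 0 < C2) : MonotoneOn (Ufun a1 a2 C1 C2) (Set.Ioi 0) := by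
  intro x hx y hy hxy
  have hlam := div_pos hC2 hC1
  have hΓ := Real.Gamma_pos_of_pos (show 0 < a2 + 1 by linarith)
  have hi := integrableOn_mlKernel hlam (sub_pos.2 ha) (by linarith)
  rw [Ufun_eq_integral_Ioi ha2 ha hC2 hx, Ufun_eq_integral_Ioi ha2 ha hC2 hy]
  refine mul_le_mul_of_nonneg_left ?_ (by positivity)
  refine setIntegral_mono_on (integrableOn_mul_max_rpow hi ha2 x)
    (integrableOn_mul_max_rpow hi ha2 y) measurableSet_Ioi fun τ hτ => ?_
  refine mul_le_mul_of_nonneg_left ?_ (mlKernel_nonneg hlam (sub_pos.2 ha) (by linarith) hτ)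
  exact Real.rpow_le_rpow (le_max_right _ _) (max_le_max (by linarith) le_rfl) ha2.le

theorem tendsto_Ufun_sub {a1 a2 C1 C2 s : ℝ} (ha2 : 0 < a2) (ha : a2 < a1) (ha1 : a1 < 1)
    (hC1 : 0 < C1) (hC2 : 0 < C2) (hs : 0 ≤ s) :
    Tendsto (fun t => Ufun a1 a2 C1 C2 t - Ufun a1 a2 C1 C2 (t - s)) atTop (𝓝 0) := by
  have hi := integrableOn_mlKernel (div_pos hC2 hC1) (sub_pos.2 ha) (by linarith)
  have h := (tendsto_integral_mul_max_rpow_sub hi ha2 (ha.trans ha1) hs).const_mul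
    (1 / (C2 * Real.Gamma (a2 + 1)))
  rw [mul_zero] at h
  refine h.congr' ?_
  filter_upwards [eventually_gt_atTop s] with t ht
  rw [Ufun_eq_integral_Ioi ha2 ha hC2 (hs.trans_lt ht),
    Ufun_eq_integral_Ioi ha2 ha hC2 (sub_pos.2 ht), mul_sub]

theorem tendsto_CovY {a1 a2 C1 C2 s : ℝ} (ha2 : 0 < a2) (ha : a2 < a1) (ha1 : a1 < 1)
    (hC1 : 0 < C1) (hC2 : 0 < C2) (hs : 0 < s) :
    Tendsto (fun t => CovY a1 a2 C1 C2 s t) atTop (𝓝 (Ifun a1 a2 C1 C2 s s)) := by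
  have ha1' := ha2.trans ha
  set U := Ufun a1 a2 C1 C2 with hU
  set u := ufun a1 a2 C1 C2 with hu
  have hui : IntervalIntegrable u volume 0 s := intervalIntegrable_ufun ha1' ha s
  have herr : Tendsto (fun t => ∫ τ in (0:ℝ)..s, (U (t - τ) - U t) * u τ) atTop (𝓝 0) := by
    have h := (tendsto_Ufun_sub ha2 ha ha1 hC1 hC2 hs.le).mul_const (∫ τ in (0:ℝ)..s, ‖u τ‖)
    rw [zero_mul] at h
    refine squeeze_zero_norm' ?_ h
    filter_upwards [eventually_gt_atTop s] with t ht
    rw [← intervalIntegral.integral_const_mul]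
    refine intervalIntegral.norm_integral_le_of_norm_le hs.le
      (Eventually.of_forall fun τ hτ => ?_) (hui.norm.const_mul _)
    have hm := monotoneOn_Ufun ha2 ha ha1 hC1 hC2
    have e0 : 0 < t := hs.trans ht
    have e1 : 0 < t - τ := by linarith [hτ.2]
    have e2 : 0 < t - s := by linarith
    have h1 := hm e1 e0 (by linarith [hτ.1])
    have h2 := hm e2 e1 (by linarith [hτ.2])
    rw [norm_mul]
    refine mul_le_mul_of_nonneg_right ?_ (norm_nonneg _)
    rw [Real.norm_of_nonpos (by linarith)]
    linarith
  have h := herr.const_add (Ifun a1 a2 C1 C2 s s)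
  rw [add_zero] at h
  refine h.congr' ?_
  filter_upwards [eventually_ge_atTop s] with t ht
  rw [CovY_eq ha1' ha ht, ← integral_ufun ha1' ha hs, Ifun, Ifun]
  simp only [sub_mul]
  rw [intervalIntegral.integral_sub (intervalIntegrable_Ufun_sub_mul_ufun ha1' ha s t)
    (hui.const_mul _), intervalIntegral.integral_const_mul]
  ring

/-- Proposition 3.3 (LRD of the inverse mixed stable subordinator): for fixed `s > 0` with
`Var_Y(s) > 0`, `t^{α₂} Corr_Y(s,t)` converges to the stated constant as `t → ∞`. -/
theorem stmt_8 (a1 a2 C1 C2 : ℝ) (ha2 : 0 < a2) (ha12 : a2 < a1) (ha1 : a1 < 1)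
    (hC1 : 0 < C1) (hC2 : 0 < C2) (hC : C1 + C2 = 1)
    (s : ℝ) (hs : 0 < s) (hv : 0 < VarY a1 a2 C1 C2 s) :
    Tendsto (fun t : ℝ => t ^ a2 * CorrY a1 a2 C1 C2 s t) atTop
      (𝓝 ((s ^ (2 * a1) / C1 ^ 2
            * ML2 (a1 - a2) (2 * a1 + 1) (-C2 * s ^ (a1 - a2) / C1))
        / (Real.sqrt (VarY a1 a2 C1 C2 s)
            * Real.sqrt (1 / C2 ^ 2
              * (2 / Real.Gamma (2 * a2 + 1) - 1 / Real.Gamma (a2 + 1) ^ 2))))) := by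
  have hK : 0 < 1 / C2 ^ 2 * (2 / Real.Gamma (2 * a2 + 1) - 1 / Real.Gamma (a2 + 1) ^ 2) := by
    have h1 := Real.Gamma_pos_of_pos (show 0 < 2 * a2 + 1 by linarith)
    have h2 := Real.Gamma_pos_of_pos (show 0 < a2 + 1 by linarith)
    refine mul_pos (by positivity) (sub_pos.2 ?_)
    rw [div_lt_div_iff₀ (by positivity) h1, one_mul]
    exact Gamma_two_mul_add_one_lt ha2 (ha12.trans ha1)
  rw [← Ifun_self_eq_ML2 (ha2.trans ha12) ha12 hs]
  have h := (tendsto_CovY ha2 ha12 ha1 hC1 hC2 hs).div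
    ((tendsto_VarY_div ha2 ha12 ha1 hC1 hC2).sqrt.const_mul (Real.sqrt (VarY a1 a2 C1 C2 s)))
    (mul_pos (Real.sqrt_pos.2 hv) (Real.sqrt_pos.2 hK)).ne'
  refine h.congr' ?_
  filter_upwards [eventually_gt_atTop 0] with t ht
  have hp : 0 < t ^ a2 := by positivity
  have e : t ^ (2 * a2) = (t ^ a2) ^ 2 := by
    rw [mul_comm, ← Real.rpow_mul_natCast ht.le]
    norm_num
  simp only [Pi.div_apply]
  rw [e, Real.sqrt_div' _ (sq_nonneg _), Real.sqrt_sq hp.le, CorrY]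
  field_simp
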